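/- Let p and q be probability distributions on {0,...,n-1} (n ≥ 1). Define their cyclic convolution (p * q)(i) = Σ_{j=0}^{n-1} p(j) · q((i - j) mod n). Then VD(p * q, U) ≤ 2 · VD(p, U) · VD(q, U), where U is the uniform distribution on {0,...,n-1} and VD is the total variation distance. -/

import Mathlib

/-- The total variation distance from uniform of the cyclic convolution of two
distributions is at most twice the product of their distances from uniform. -/
theorem vd_conv_le_two_mul (n : ℕ) [NeZero n]
    (p q : ZMod n → ℝ)
    (hp0 : ∀ i, 0 ≤ p i) (hq0 : ∀ i, 0 ≤ q i)
    (hp1 : ∑ i, p i = 1) (hq1 : ∑ i, q i = 1) :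
    (1 / 2) * ∑ i : ZMod n, |(∑ j : ZMod n, p j * q (i - j)) - 1 / n|
      ≤ 2 * ((1 / 2) * ∑ i : ZMod n, |p i - 1 / n|)
          * ((1 / 2) * ∑ i : ZMod n, |q i - 1 / n|) := by
  have hn : (n : ℝ) ≠ 0 := Nat.cast_ne_zero.mpr (NeZero.ne n)
  have hshift : ∀ i : ZMod n, ∑ j, q (i - j) = 1 := fun i => by
    rw [← hq1]
    exact Equiv.sum_comp (Equiv.subLeft i) q
  have key : ∀ i : ZMod n, (∑ j : ZMod n, p j * q (i - j)) - 1 / n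
      = ∑ j : ZMod n, (p j - 1 / n) * (q (i - j) - 1 / n) := fun i => by
    have h : ∀ j : ZMod n, (p j - 1 / n) * (q (i - j) - 1 / n)
        = p j * q (i - j) - p j * (1 / n) - (1 / n) * q (i - j) + (1 / n) * (1 / n) :=
      fun j => by ring
    simp_rw [h]
    rw [Finset.sum_add_distrib, Finset.sum_sub_distrib, Finset.sum_sub_distrib,
      ← Finset.sum_mul, ← Finset.mul_sum, hp1, hshift, Finset.sum_const, Finset.card_univ,
      ZMod.card, nsmul_eq_mul]
    field_simp
    ring
  have main : ∑ i : ZMod n, |(∑ j : ZMod n, p j * q (i - j)) - 1 / n|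
      ≤ (∑ i : ZMod n, |p i - 1 / n|) * ∑ i : ZMod n, |q i - 1 / n| := by
    calc _ ≤ ∑ i : ZMod n, ∑ j : ZMod n, |p j - 1 / n| * |q (i - j) - 1 / n| := by
          refine Finset.sum_le_sum fun i _ => ?_
          rw [key]
          refine (Finset.abs_sum_le_sum_abs _ _).trans (le_of_eq ?_)
          simp_rw [abs_mul]
      _ = _ := by
          rw [Finset.sum_comm, Finset.sum_mul]
          refine Finset.sum_congr rfl fun j _ => ?_
          rw [← Finset.mul_sum]
          congr 1
          exact Equiv.sum_comp (Equiv.subRight j) (fun i => |q i - 1 / n|)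
  linarith
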